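/- There are exactly 27 *-sets. -/

import Mathlib

open Matrix

noncomputable section

/-- Gram matrix of the even lattice `2U(3) ⊕ A₂`. -/
def GramB : Matrix (Fin 6) (Fin 6) ℚ :=
  !![0,0,0,0,0,3; 0,0,0,0,3,0; 0,0,2,1,0,0; 0,0,1,2,0,0; 0,3,0,0,0,0; 3,0,0,0,0,0]

/-- The bilinear form on `V = ℚ⁶` with Gram matrix `GramB`. -/
def BB (x y : Fin 6 → ℚ) : ℚ := x ⬝ᵥ GramB.mulVec y

/-- The lattice `M = ℤ⁶ ⊆ ℚ⁶`. -/
def MB : AddSubgroup (Fin 6 → ℚ) where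
  carrier := {x | ∀ i, ∃ n : ℤ, x i = (n : ℚ)}
  zero_mem' := fun i => ⟨0, by simp⟩
  add_mem' := by
    intro a b ha hb i
    obtain ⟨n, hn⟩ := ha i
    obtain ⟨m, hm⟩ := hb i
    exact ⟨n + m, by simp [hn, hm]⟩
  neg_mem' := by
    intro a ha i
    obtain ⟨n, hn⟩ := ha i
    exact ⟨-n, by simp [hn]⟩

/-- The dual lattice `M^∨ = {x ∈ V : B(x,m) ∈ ℤ for all m ∈ M}`. -/
def MBdual : Set (Fin 6 → ℚ) := {x | ∀ m ∈ MB, ∃ n : ℤ, BB x m = (n : ℚ)}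

/-- The quotient `V/M` (containing the discriminant group `M^∨/M`). -/
abbrev QB := (Fin 6 → ℚ) ⧸ MB

/-- The projection `V → V/M`. -/
def pB : (Fin 6 → ℚ) → QB := QuotientAddGroup.mk

/-- A singular class: an unordered pair `{v+M, −v+M}` of cosets of order 3 in `M^∨/M`
with a representative `v` satisfying `B(v,v) = 2/3`. -/
def IsSingular (c : Sym2 QB) : Prop :=
  ∃ v : Fin 6 → ℚ, v ∈ MBdual ∧ addOrderOf (pB v) = 3 ∧ BB v v = 2/3 ∧
    c = s(pB v, pB (-v))

/-- The reflection `σ_v(x) = x − 3·B(v,x)·v` (for `B(v,v) = 2/3`). -/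
def reflB (v x : Fin 6 → ℚ) : Fin 6 → ℚ := x - (3 * BB v x) • v

/-- A `*`-set: five distinct singular classes such that `σ_v(v') ∈ (v'+M) ∪ (−v'+M)`
whenever `v, v' ∈ M^∨` have `B(v,v) = B(v',v') = 2/3` and represent cosets of
(possibly equal) classes of the set. -/
def IsStarSetB (S : Set (Sym2 QB)) : Prop :=
  S.ncard = 5 ∧ (∀ c ∈ S, IsSingular c) ∧
  ∀ v v' : Fin 6 → ℚ, v ∈ MBdual → v' ∈ MBdual →
    BB v v = 2/3 → BB v' v' = 2/3 →
    (∃ c ∈ S, pB v ∈ c) → (∃ c' ∈ S, pB v' ∈ c') →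
    (reflB v v' - v' ∈ MB ∨ reflB v v' + v' ∈ MB)

def repL : List (ℤ × ℤ × ℤ × ℤ × ℤ) :=
  [(0, 0, 1, 0, 0), (0, 0, 1, 0, 1), (0, 0, 1, 0, -1), (0, 0, 1, 1, 0), (0, 0, 1, 1, 1),
   (0, 0, 1, 1, -1), (0, 0, 1, -1, 0), (0, 0, 1, -1, 1), (0, 0, 1, -1, -1), (0, 1, 0, 1, 0),
   (0, 1, 0, 1, 1), (0, 1, 0, 1, -1), (0, 1, 1, 0, 0), (0, 1, 1, 0, 1), (0, 1, 1, 0, -1),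
   (0, 1, -1, 0, 0), (0, 1, -1, 0, 1), (0, 1, -1, 0, -1), (1, 0, 0, 0, 1), (1, 0, 0, 1, 1),
   (1, 0, 0, -1, 1), (1, 0, 1, 0, 0), (1, 0, 1, 1, 0), (1, 0, 1, -1, 0), (1, 0, -1, 0, 0),
   (1, 0, -1, 1, 0), (1, 0, -1, -1, 0), (1, 1, 0, 0, 1), (1, 1, 0, 1, 0), (1, 1, 0, -1, 2),
   (1, 1, 1, 0, 0), (1, 1, 1, 1, -1), (1, 1, 1, -1, 1), (1, 1, -1, 0, 0), (1, 1, -1, 1, -1),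
   (1, 1, -1, -1, 1), (1, -1, 0, 0, 1), (1, -1, 0, 1, 2), (1, -1, 0, -1, 0), (1, -1, 1, 0, 0),
   (1, -1, 1, 1, 1), (1, -1, 1, -1, -1), (1, -1, -1, 0, 0), (1, -1, -1, 1, 1), (1, -1, -1, -1, -1)]

def frameL : List (List (Fin 45)) :=
  [[0, 9, 18, 29, 37], [0, 10, 20, 28, 36], [0, 11, 19, 27, 38], [1, 9, 21, 32, 40],
   [1, 10, 23, 31, 39], [1, 11, 22, 30, 41], [2, 9, 24, 35, 43], [2, 10, 26, 34, 42],
   [2, 11, 25, 33, 44], [3, 12, 18, 31, 44], [3, 13, 20, 30, 43], [3, 14, 19, 32, 42],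
   [4, 12, 22, 35, 36], [4, 13, 21, 34, 38], [4, 14, 23, 33, 37], [5, 12, 26, 27, 40],
   [5, 13, 25, 29, 39], [5, 14, 24, 28, 41], [6, 15, 18, 34, 41], [6, 16, 20, 33, 40],
   [6, 17, 19, 35, 39], [7, 15, 23, 27, 43], [7, 16, 22, 29, 42], [7, 17, 21, 28, 44],
   [8, 15, 25, 32, 36], [8, 16, 24, 31, 38], [8, 17, 26, 30, 37]]

/-- The `i`-th representative, as integer coordinates `(a, b, p, c, d)`. -/
def rp (i : Fin 45) : ℤ × ℤ × ℤ × ℤ × ℤ := repL.getD i.val (0, 0, 0, 0, 0)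

def frame (f : Fin 27) : Finset (Fin 45) := (frameL.getD f.val []).toFinset

def prd (x y : ℤ × ℤ × ℤ × ℤ × ℤ) : ℤ :=
  x.1 * y.2.2.2.2 + x.2.2.2.2 * y.1 + x.2.1 * y.2.2.2.1 + x.2.2.2.1 * y.2.1
    + 2 * (x.2.2.1 * y.2.2.1)

abbrev orth (i j : Fin 45) : Prop := prd (rp i) (rp j) % 3 = 0

/-- `x ≡ e y` modulo 3. -/
abbrev cong (e : ℤ) (x y : ℤ × ℤ × ℤ × ℤ × ℤ) : Prop :=
  (x.1 - e * y.1) % 3 = 0 ∧ (x.2.1 - e * y.2.1) % 3 = 0 ∧ (x.2.2.1 - e * y.2.2.1) % 3 = 0 ∧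
  (x.2.2.2.1 - e * y.2.2.2.1) % 3 = 0 ∧ (x.2.2.2.2 - e * y.2.2.2.2) % 3 = 0

theorem rp_norm : ∀ i : Fin 45, prd (rp i) (rp i) = 2 := by decide +kernel

theorem rp_inj : ∀ i j : Fin 45, cong 1 (rp i) (rp j) ∨ cong (-1) (rp i) (rp j) → i = j := by
  decide +kernel

theorem rp_cond : ∀ i j : Fin 45,
    (cong (prd (rp i) (rp j)) (0, 0, 0, 0, 0) (rp i) ∨
      cong (prd (rp i) (rp j)) (2 * (rp j).1, 2 * (rp j).2.1, 2 * (rp j).2.2.1,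
        2 * (rp j).2.2.2.1, 2 * (rp j).2.2.2.2) (rp i)) → i = j ∨ orth i j := by
  decide +kernel

theorem classify_fin : ∀ a b p c d : Fin 3,
    ((a.val : ℤ) * d.val + b.val * c.val + p.val * p.val) % 3 = 1 →
    ∃ i : Fin 45, cong 1 ((a.val : ℤ), (b.val : ℤ), (p.val : ℤ), (c.val : ℤ), (d.val : ℤ)) (rp i) ∨
      cong (-1) ((a.val : ℤ), (b.val : ℤ), (p.val : ℤ), (c.val : ℤ), (d.val : ℤ)) (rp i) := by
  decide +kernel

theorem frame_card : ∀ f : Fin 27, (frame f).card = 5 := by decide +kernel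

theorem frame_inj : ∀ f g : Fin 27, frame f = frame g → f = g := by decide +kernel

theorem frame_orth : ∀ f : Fin 27, ∀ i ∈ frame f, ∀ j ∈ frame f, i = j ∨ orth i j := by
  decide +kernel

theorem frame_max : ∀ i j : Fin 45, i ≠ j → orth i j → ∃ f : Fin 27, i ∈ frame f ∧ j ∈ frame f ∧
    ∀ k : Fin 45, (i = k ∨ orth i k) → (j = k ∨ orth j k) → k ∈ frame f := by
  decide +kernel

theorem clique_eq (T : Finset (Fin 45)) (hc : T.card = 5)
    (h : ∀ i ∈ T, ∀ j ∈ T, i = j ∨ orth i j) : ∃ f, T = frame f := by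
  obtain ⟨i, hi, j, hj, hij⟩ := Finset.one_lt_card.1 (by omega : 1 < T.card)
  obtain ⟨f, -, -, hf⟩ := frame_max i j hij ((h i hi j hj).resolve_left hij)
  refine ⟨f, Finset.eq_of_subset_of_card_le (fun k hk => hf k (h i hi k hk) (h j hj k hk)) ?_⟩
  rw [frame_card, hc]

theorem exists_fin3 (a : ℤ) : ∃ (x : Fin 3) (m : ℤ), a = x.val + 3 * m :=
  ⟨⟨(a % 3).toNat, by omega⟩, a / 3, by simp only; omega⟩

theorem classify (a b p c d : ℤ) (h : (a * d + b * c + p * p) % 3 = 1) :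
    ∃ i : Fin 45, cong 1 (a, b, p, c, d) (rp i) ∨ cong (-1) (a, b, p, c, d) (rp i) := by
  obtain ⟨a', a1, rfl⟩ := exists_fin3 a
  obtain ⟨b', b1, rfl⟩ := exists_fin3 b
  obtain ⟨p', p1, rfl⟩ := exists_fin3 p
  obtain ⟨c', c1, rfl⟩ := exists_fin3 c
  obtain ⟨d', d1, rfl⟩ := exists_fin3 d
  have h' : ((a'.val : ℤ) * d'.val + b'.val * c'.val + p'.val * p'.val) % 3 = 1 := by
    rw [← h]
    apply Int.emod_emod_of_dvd _ (dvd_refl 3) |>.symm.trans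
    rw [Int.emod_emod_of_dvd _ (dvd_refl 3)]
    apply Int.ModEq.symm
    apply (Int.modEq_iff_dvd).2
    exact ⟨-(a' * d1 + a1 * d' + 3 * a1 * d1 + b' * c1 + b1 * c' + 3 * b1 * c1 + 2 * p' * p1
      + 3 * p1 * p1), by ring⟩
  obtain ⟨i, hi⟩ := classify_fin a' b' p' c' d' h'
  refine ⟨i, hi.imp ?_ ?_⟩
  · rintro ⟨h1, h2, h3, h4, h5⟩
    simp only [cong] at *
    omega
  · rintro ⟨h1, h2, h3, h4, h5⟩
    simp only [cong] at *
    omega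

/-- The general element of the dual lattice. -/
def D (x : ℤ × ℤ × ℤ × ℤ × ℤ) (k : ℤ) : Fin 6 → ℚ :=
  ![x.1 / 3, x.2.1 / 3, x.2.2.1 / 3, x.2.2.1 / 3 + k, x.2.2.2.1 / 3, x.2.2.2.2 / 3]

theorem BB_eq (x y : Fin 6 → ℚ) : BB x y = 3 * (x 0 * y 5 + x 5 * y 0 + x 1 * y 4 + x 4 * y 1)
    + 2 * x 2 * y 2 + x 2 * y 3 + x 3 * y 2 + 2 * x 3 * y 3 := by
  simp [BB, GramB, Matrix.mulVec, dotProduct, Fin.sum_univ_succ]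
  ring

theorem BB_D (x y : ℤ × ℤ × ℤ × ℤ × ℤ) (k l : ℤ) : BB (D x k) (D y l) =
    ((prd x y + 3 * (x.2.2.1 * l + k * y.2.2.1 + 2 * k * l) : ℤ) : ℚ) / 3 := by
  rw [BB_eq]
  simp [D, prd]
  ring

theorem int_third (a : ℤ) : (∃ n : ℤ, (a : ℚ) / 3 = n) ↔ a % 3 = 0 := by
  constructor
  · rintro ⟨n, hn⟩
    have : (a : ℚ) = ((3 * n : ℤ) : ℚ) := by push_cast; linarith
    have : a = 3 * n := by exact_mod_cast this
    omega
  · intro h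
    refine ⟨a / 3, ?_⟩
    have : a = 3 * (a / 3) := by omega
    have : (a : ℚ) = 3 * ((a / 3 : ℤ) : ℚ) := by exact_mod_cast this
    linarith

theorem D_mem (x : ℤ × ℤ × ℤ × ℤ × ℤ) (k : ℤ) : D x k ∈ MB ↔
    x.1 % 3 = 0 ∧ x.2.1 % 3 = 0 ∧ x.2.2.1 % 3 = 0 ∧ x.2.2.2.1 % 3 = 0 ∧ x.2.2.2.2 % 3 = 0 := by
  have e : D x k ∈ MB ↔ ∀ i, ∃ n : ℤ, D x k i = (n : ℚ) := Iff.rfl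
  rw [e, ← int_third, ← int_third, ← int_third, ← int_third, ← int_third]
  constructor
  · intro h
    exact ⟨h 0, h 1, h 2, h 4, h 5⟩
  · rintro ⟨h0, h1, h2, h4, h5⟩ i
    fin_cases i
    · exact h0
    · exact h1
    · exact h2
    · obtain ⟨n, hn⟩ := h2
      exact ⟨n + k, by simp [D, hn]⟩
    · exact h4
    · exact h5

theorem D_lin (e : ℤ) (x y : ℤ × ℤ × ℤ × ℤ × ℤ) (k l : ℤ) : D x k - (e : ℚ) • D y l =
    D (x.1 - e * y.1, x.2.1 - e * y.2.1, x.2.2.1 - e * y.2.2.1, x.2.2.2.1 - e * y.2.2.2.1,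
      x.2.2.2.2 - e * y.2.2.2.2) (k - e * l) := by
  ext i
  fin_cases i <;> simp [D] <;> ring

theorem D_cong (e : ℤ) (x y : ℤ × ℤ × ℤ × ℤ × ℤ) (k l : ℤ) :
    D x k - (e : ℚ) • D y l ∈ MB ↔ cong e x y := by
  rw [D_lin, D_mem]

theorem dual_D (x : ℤ × ℤ × ℤ × ℤ × ℤ) (k : ℤ) : D x k ∈ MBdual := by
  intro m hm
  obtain ⟨m0, h0⟩ := hm 0
  obtain ⟨m1, h1⟩ := hm 1
  obtain ⟨m2, h2⟩ := hm 2
  obtain ⟨m3, h3⟩ := hm 3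
  obtain ⟨m4, h4⟩ := hm 4
  obtain ⟨m5, h5⟩ := hm 5
  refine ⟨x.1 * m5 + x.2.2.2.2 * m0 + x.2.1 * m4 + x.2.2.2.1 * m1 + x.2.2.1 * (m2 + m3)
    + k * m2 + 2 * k * m3, ?_⟩
  rw [BB_eq, h0, h1, h2, h3, h4, h5]
  simp [D]
  ring

theorem single_mem (i : Fin 6) : (Pi.single i 1 : Fin 6 → ℚ) ∈ MB := by
  intro j
  by_cases h : j = i
  · subst h
    exact ⟨1, by simp⟩
  · exact ⟨0, by simp [h]⟩

theorem exists_D (v : Fin 6 → ℚ) (hv : v ∈ MBdual) : ∃ x k, v = D x k := by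
  obtain ⟨d, hd⟩ := hv _ (single_mem 0)
  obtain ⟨c, hc⟩ := hv _ (single_mem 1)
  obtain ⟨n, hn⟩ := hv _ (single_mem 2)
  obtain ⟨m, hm⟩ := hv _ (single_mem 3)
  obtain ⟨b, hb⟩ := hv _ (single_mem 4)
  obtain ⟨a, ha⟩ := hv _ (single_mem 5)
  rw [BB_eq] at ha hb hc hd hn hm
  simp at ha hb hc hd hn hm
  refine ⟨(a, b, 2 * n - m, c, d), m - n, ?_⟩
  ext i
  fin_cases i <;> simp [D] <;> linarith

theorem exists_class (v : Fin 6 → ℚ) (hv : v ∈ MBdual) (h : BB v v = 2 / 3) :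
    ∃ x k i, v = D x k ∧ (cong 1 x (rp i) ∨ cong (-1) x (rp i)) := by
  obtain ⟨x, k, rfl⟩ := exists_D v hv
  rw [BB_D] at h
  have h2 : ((prd x x + 3 * (x.2.2.1 * k + k * x.2.2.1 + 2 * k * k) : ℤ) : ℚ) = ((2 : ℤ) : ℚ) := by
    push_cast at h ⊢
    linarith
  have h3 := Int.cast_injective h2
  obtain ⟨a, b, p, c, d⟩ := x
  have h4 : a * d + b * c + p * p = 1 - 3 * (p * k + k * k) := by
    simp only [prd] at h3
    linarith
  obtain ⟨i, hi⟩ := classify a b p c d (by omega)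
  exact ⟨_, k, i, rfl, hi⟩

def rv (i : Fin 45) : Fin 6 → ℚ := D (rp i) 0

theorem rv_norm (i : Fin 45) : BB (rv i) (rv i) = 2 / 3 := by
  rw [rv, BB_D, rp_norm]
  norm_num

def cl (i : Fin 45) : Sym2 QB := s(pB (rv i), pB (-rv i))

theorem pB_eq (v w : Fin 6 → ℚ) : pB v = pB w ↔ v - w ∈ MB := by
  have e : pB v = pB w ↔ (QuotientAddGroup.mk v : QB) = QuotientAddGroup.mk w := Iff.rfl
  rw [e, QuotientAddGroup.eq, ← MB.neg_mem_iff]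
  have : -(-v + w) = v - w := by abel
  rw [this]

theorem mem_cl (x : ℤ × ℤ × ℤ × ℤ × ℤ) (k : ℤ) (i : Fin 45) :
    pB (D x k) ∈ cl i ↔ cong 1 x (rp i) ∨ cong (-1) x (rp i) := by
  rw [cl, Sym2.mem_iff, pB_eq, pB_eq, ← D_cong 1 x (rp i) k 0, ← D_cong (-1) x (rp i) k 0]
  simp [rv]

theorem cl_inj : Function.Injective cl := by
  intro i j h
  have : pB (rv i) ∈ cl j := by
    rw [← h, cl]
    exact Sym2.mem_mk_left _ _
  rw [rv, mem_cl] at this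
  exact rp_inj i j this

theorem cl_eq (v : Fin 6 → ℚ) (i : Fin 45) (h : pB v ∈ cl i) : s(pB v, pB (-v)) = cl i := by
  have hneg : ∀ w : Fin 6 → ℚ, pB (-w) = -pB w := fun w => rfl
  rw [cl, Sym2.mem_iff] at h
  rcases h with h | h
  · rw [cl, hneg, hneg, h]
  · rw [cl, hneg, h, hneg, neg_neg, Sym2.eq_swap]

theorem singular_cl (i : Fin 45) : IsSingular (cl i) := by
  refine ⟨rv i, dual_D _ _, ?_, rv_norm i, rfl⟩
  have : Fact (Nat.Prime 3) := ⟨Nat.prime_three⟩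
  apply addOrderOf_eq_prime
  · have h : (3 : ℕ) • pB (rv i) = pB ((3 : ℕ) • rv i) := rfl
    have h0 : (0 : QB) = pB 0 := rfl
    rw [h, h0, pB_eq]
    have := (D_cong (-2) (rp i) (rp i) 0 0).2 (by simp only [cong]; omega)
    convert this using 1
    ext j
    simp [rv]
    ring
  · intro h
    have h0 : (0 : QB) = pB 0 := rfl
    rw [h0, pB_eq, sub_zero] at h
    obtain ⟨n, hn⟩ := dual_D (rp i) 0 _ h
    have h2 := rv_norm i
    rw [rv] at h2
    rw [rv, h2] at hn
    have : ((2 : ℤ) : ℚ) / 3 = n := by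
      rw [← hn]
      norm_num
    have := (int_third 2).1 ⟨n, this⟩
    omega

theorem singular_iff (c : Sym2 QB) : IsSingular c ↔ ∃ i, c = cl i := by
  constructor
  · rintro ⟨v, hv, -, hn, rfl⟩
    obtain ⟨x, k, i, rfl, hi⟩ := exists_class v hv hn
    exact ⟨i, cl_eq _ _ ((mem_cl x k i).2 hi)⟩
  · rintro ⟨i, rfl⟩
    exact singular_cl i

theorem refl_D (x y : ℤ × ℤ × ℤ × ℤ × ℤ) (k l : ℤ) : ∃ N : ℤ,
    N = prd x y + 3 * (x.2.2.1 * l + k * y.2.2.1 + 2 * k * l) ∧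
    (reflB (D x k) (D y l) - D y l ∈ MB ↔ cong N (0, 0, 0, 0, 0) x) ∧
    (reflB (D x k) (D y l) + D y l ∈ MB ↔
      cong N (2 * y.1, 2 * y.2.1, 2 * y.2.2.1, 2 * y.2.2.2.1, 2 * y.2.2.2.2) x) := by
  refine ⟨_, rfl, ?_, ?_⟩
  · rw [← D_cong _ _ _ 0 k, reflB, BB_D]
    have : D (0, 0, 0, 0, 0) 0 = 0 := by
      ext i
      fin_cases i <;> simp [D]
    rw [this, mul_div_cancel₀ _ (by norm_num : (3 : ℚ) ≠ 0)]
    have e : ∀ (u w : Fin 6 → ℚ), u - w - u = 0 - w := fun u w => by abel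
    rw [e]
  · rw [← D_cong _ _ _ (2 * l) k, reflB, BB_D]
    have : D (2 * y.1, 2 * y.2.1, 2 * y.2.2.1, 2 * y.2.2.2.1, 2 * y.2.2.2.2) (2 * l)
        = D y l + D y l := by
      ext i
      fin_cases i <;> simp [D] <;> ring
    rw [this, mul_div_cancel₀ _ (by norm_num : (3 : ℚ) ≠ 0)]
    have e : ∀ (u w : Fin 6 → ℚ), u - w + u = u + u - w := fun u w => by abel
    rw [e]

theorem refl_only_if (i j : Fin 45)
    (h : reflB (rv i) (rv j) - rv j ∈ MB ∨ reflB (rv i) (rv j) + rv j ∈ MB) :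
    i = j ∨ orth i j := by
  obtain ⟨N, hN, h1, h2⟩ := refl_D (rp i) (rp j) 0 0
  rw [rv, rv, h1, h2] at h
  have : N = prd (rp i) (rp j) := by rw [hN]; ring
  rw [this] at h
  exact rp_cond i j h

theorem cong_elim (e : ℤ) (x y : ℤ × ℤ × ℤ × ℤ × ℤ) (h : cong e x y) : ∃ z : ℤ × ℤ × ℤ × ℤ × ℤ,
    x = (e * y.1 + 3 * z.1, e * y.2.1 + 3 * z.2.1, e * y.2.2.1 + 3 * z.2.2.1,
      e * y.2.2.2.1 + 3 * z.2.2.2.1, e * y.2.2.2.2 + 3 * z.2.2.2.2) := by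
  obtain ⟨a, b, p, c, d⟩ := x
  obtain ⟨h1, h2, h3, h4, h5⟩ := h
  refine ⟨((a - e * y.1) / 3, (b - e * y.2.1) / 3, (p - e * y.2.2.1) / 3,
    (c - e * y.2.2.2.1) / 3, (d - e * y.2.2.2.2) / 3), ?_⟩
  simp only [Prod.mk.injEq] at *
  omega

theorem sign_cong (i : Fin 45) (x : ℤ × ℤ × ℤ × ℤ × ℤ)
    (h : cong 1 x (rp i) ∨ cong (-1) x (rp i)) : ∃ e : ℤ, e * e = 1 ∧ cong e x (rp i) := by
  rcases h with h | h
  · exact ⟨1, by norm_num, h⟩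
  · exact ⟨-1, by norm_num, h⟩

theorem prd_cong (e f : ℤ) (x y u w : ℤ × ℤ × ℤ × ℤ × ℤ) (hx : cong e x u) (hy : cong f y w) :
    ∃ m, prd x y = e * f * prd u w + 3 * m := by
  obtain ⟨z, rfl⟩ := cong_elim e x u hx
  obtain ⟨t, rfl⟩ := cong_elim f y w hy
  refine ⟨e * prd u t + f * prd z w + 3 * prd z t, ?_⟩
  simp only [prd]
  ring

theorem refl_if (i j : Fin 45) (x y : ℤ × ℤ × ℤ × ℤ × ℤ) (k l : ℤ)
    (hx : cong 1 x (rp i) ∨ cong (-1) x (rp i)) (hy : cong 1 y (rp j) ∨ cong (-1) y (rp j))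
    (h : i = j ∨ orth i j) :
    reflB (D x k) (D y l) - D y l ∈ MB ∨ reflB (D x k) (D y l) + D y l ∈ MB := by
  obtain ⟨N, hN, h1, h2⟩ := refl_D x y k l
  rw [h1, h2]
  obtain ⟨e, he, hx⟩ := sign_cong i x hx
  obtain ⟨f, hf, hy⟩ := sign_cong j y hy
  obtain ⟨m, hm⟩ := prd_cong e f x y _ _ hx hy
  rcases h with rfl | h
  · right
    rw [rp_norm] at hm
    obtain ⟨z, rfl⟩ := cong_elim e x _ hx
    obtain ⟨t, rfl⟩ := cong_elim f y _ hy
    generalize rp i = r at *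
    obtain ⟨q, hq⟩ : ∃ q, N = 2 * e * f + 3 * q := by
      refine ⟨m + (N - prd (e * r.1 + 3 * z.1, e * r.2.1 + 3 * z.2.1, e * r.2.2.1 + 3 * z.2.2.1,
      e * r.2.2.2.1 + 3 * z.2.2.2.1, e * r.2.2.2.2 + 3 * z.2.2.2.2) (f * r.1 + 3 * t.1, f * r.2.1 + 3 * t.2.1, f * r.2.2.1 + 3 * t.2.2.1,
      f * r.2.2.2.1 + 3 * t.2.2.2.1, f * r.2.2.2.2 + 3 * t.2.2.2.2)) / 3, ?_⟩
      rw [hm] at hN ⊢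
      have : 2 * e * f = e * f * 2 := by ring
      omega
    have key : ∀ r z t : ℤ, (2 * (f * r + 3 * t) - N * (e * r + 3 * z)) % 3 = 0 := by
      intro r z t
      apply Int.emod_eq_zero_of_dvd
      refine ⟨2 * t - q * e * r - N * z, ?_⟩
      rw [hq]
      linear_combination (-2 * f * r) * he
    exact ⟨key _ _ _, key _ _ _, key _ _ _, key _ _ _, key _ _ _⟩
  · left
    have hd : (3 : ℤ) ∣ N := by
      rw [hN, hm]
      have : (3 : ℤ) ∣ prd (rp i) (rp j) := Int.dvd_of_emod_eq_zero h
      exact dvd_add (dvd_add (this.mul_left _) (dvd_mul_right _ _)) (dvd_mul_right _ _)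
    have key : ∀ r : ℤ, (0 - N * r) % 3 = 0 := by
      intro r
      apply Int.emod_eq_zero_of_dvd
      exact dvd_sub (dvd_zero _) (hd.mul_right _)
    exact ⟨key _, key _, key _, key _, key _⟩

theorem star_frame (f : Fin 27) : IsStarSetB (Set.image cl (frame f : Set (Fin 45))) := by
  refine ⟨?_, ?_, ?_⟩
  · rw [Set.ncard_image_of_injective _ cl_inj, Set.ncard_coe_finset, frame_card]
  · rintro c ⟨i, -, rfl⟩
    exact singular_cl i
  · rintro v v' hv hv' - - ⟨_, ⟨i, hi, rfl⟩, h1⟩ ⟨_, ⟨j, hj, rfl⟩, h2⟩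
    obtain ⟨x, k, rfl⟩ := exists_D v hv
    obtain ⟨y, l, rfl⟩ := exists_D v' hv'
    rw [mem_cl] at h1 h2
    exact refl_if i j x y k l h1 h2 (frame_orth f i hi j hj)

theorem star_only (S : Set (Sym2 QB)) (h : IsStarSetB S) :
    ∃ f : Fin 27, Set.image cl (frame f : Set (Fin 45)) = S := by
  classical
  obtain ⟨hc, hs, hr⟩ := h
  let T : Finset (Fin 45) := Finset.univ.filter (fun i => cl i ∈ S)
  have hT : Set.image cl (T : Set (Fin 45)) = S := by
    ext c
    constructor
    · rintro ⟨i, hi, rfl⟩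
      simpa [T] using hi
    · intro hcS
      obtain ⟨i, rfl⟩ := (singular_iff c).1 (hs c hcS)
      exact ⟨i, by simpa [T] using hcS, rfl⟩
  have hcard : T.card = 5 := by
    rw [← hc, ← hT, Set.ncard_image_of_injective _ cl_inj, Set.ncard_coe_finset]
  have hm : ∀ i, pB (rv i) ∈ cl i := fun i => Sym2.mem_mk_left _ _
  obtain ⟨f, hf⟩ := clique_eq T hcard (by
    intro i hi j hj
    apply refl_only_if
    exact hr _ _ (dual_D _ _) (dual_D _ _) (rv_norm i) (rv_norm j)
      ⟨cl i, by simpa [T] using hi, hm i⟩ ⟨cl j, by simpa [T] using hj, hm j⟩)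
  exact ⟨f, by rw [← hf, hT]⟩

/-- There are exactly 27 `*`-sets. -/
theorem statement10 : {S : Set (Sym2 QB) | IsStarSetB S}.ncard = 27 := by
  have h : {S : Set (Sym2 QB) | IsStarSetB S}
      = Set.range (fun f : Fin 27 => Set.image cl (frame f : Set (Fin 45))) := by
    ext S
    constructor
    · intro h
      exact star_only S h
    · rintro ⟨f, rfl⟩
      exact star_frame f
  rw [h, ← Set.image_univ, Set.ncard_image_of_injective]
  · simp [Set.ncard_univ]
  · intro f g hfg
    exact frame_inj f g (Finset.coe_injective (cl_inj.image_injective hfg))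

end
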